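/- arXiv:1108.1555 — 3 statements merged into one kernel-verified Lean document; each statement's English description precedes it below -/
import Mathlib

section
/- For every multidegree m = (m_1,…,m_n) ∈ ℕ^n and every integer i ≥ 0, the ℂ-vector space of polynomials f ∈ R of multidegree m satisfying D1(f) = 0 and E(f) = i·f has dimension ω_d(m;i) − ω_d(m;i+2). -/
open MvPolynomial

/-- Index type for the variables `v^{(k)}_j`, `1 ≤ k ≤ n`, `0 ≤ j ≤ d k`. -/
abbrev Idx (n : ℕ) (d : Fin n → ℕ) := Σ k : Fin n, Fin (d k + 1)

/-- The derivation `D1` with `D1 (v^{(k)}_j) = j • v^{(k)}_{j-1}`. -/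
noncomputable def D1 (n : ℕ) (d : Fin n → ℕ) :
    Derivation ℂ (MvPolynomial (Idx n d) ℂ) (MvPolynomial (Idx n d) ℂ) :=
  mkDerivation ℂ (fun x =>
    if h : x.2.1 = 0 then 0
    else (x.2.1 : ℂ) • X ⟨x.1, ⟨x.2.1 - 1, by have := x.2.isLt; omega⟩⟩)

/-- The derivation `D2` with `D2 (v^{(k)}_j) = (d k - j) • v^{(k)}_{j+1}`. -/
noncomputable def D2 (n : ℕ) (d : Fin n → ℕ) :
    Derivation ℂ (MvPolynomial (Idx n d) ℂ) (MvPolynomial (Idx n d) ℂ) :=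
  mkDerivation ℂ (fun x =>
    if h : x.2.1 = d x.1 then 0
    else ((d x.1 - x.2.1 : ℕ) : ℂ) • X ⟨x.1, ⟨x.2.1 + 1, by have := x.2.isLt; omega⟩⟩)

/-- The derivation `E` with `E (v^{(k)}_j) = (d k - 2 j) • v^{(k)}_j`. -/
noncomputable def E (n : ℕ) (d : Fin n → ℕ) :
    Derivation ℂ (MvPolynomial (Idx n d) ℂ) (MvPolynomial (Idx n d) ℂ) :=
  mkDerivation ℂ (fun x => ((d x.1 : ℂ) - 2 * (x.2.1 : ℂ)) • X x)

/-- The subspace of polynomials of multidegree `m`: every monomial has total degree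
`m k` in the variables `v^{(k)}_0, …, v^{(k)}_{d k}`, for each `k`. -/
noncomputable def mdeg (n : ℕ) (d : Fin n → ℕ) (m : Fin n → ℕ) :
    Submodule ℂ (MvPolynomial (Idx n d) ℂ) where
  carrier := {f | ∀ α ∈ f.support, ∀ k : Fin n,
    (∑ j : Fin (d k + 1), α ⟨k, j⟩) = m k}
  add_mem' := by
    intro f g hf hg α hα k
    rcases Finset.mem_union.mp (MvPolynomial.support_add hα) with h | h
    · exact hf α h k
    · exact hg α h k
  zero_mem' := by
    intro α hα k
    simp at hα
  smul_mem' := by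
    intro c f hf α hα k
    exact hf α (MvPolynomial.support_smul hα) k

/-- `ω_d(m; i)`: the number of families of nonnegative integers
`(α^{(k)}_j)` with `∑_j α^{(k)}_j = m k` for each `k` and
`∑_{k,j} (d k - 2 j) ⬝ α^{(k)}_j = i`. -/
noncomputable def omegaCount (n : ℕ) (d : Fin n → ℕ) (m : Fin n → ℕ) (i : ℤ) : ℕ :=
  Nat.card {α : Idx n d → ℕ //
    (∀ k : Fin n, (∑ j : Fin (d k + 1), α ⟨k, j⟩) = m k) ∧
    (∑ k : Fin n, ∑ j : Fin (d k + 1),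
      ((d k : ℤ) - 2 * (j : ℕ)) * (α ⟨k, j⟩ : ℤ)) = i}

open MvPolynomial

section Abstract

variable {V : Type*} [AddCommGroup V] [Module ℂ V]

/-- sl2 formula on a primitive vector -/
lemma sl2_aux_e_f_pow (e f h : Module.End ℂ V)
    (hef : ∀ x, e (f x) - f (e x) = h x) (hhf : ∀ x, h (f x) - f (h x) = (-2 : ℂ) • f x)
    (x : V) (c : ℂ) (hex : e x = 0) (hx : h x = c • x) (k : ℕ) :
    h ((f ^ k) x) = (c - 2 * k) • (f ^ k) x ∧
    e ((f ^ (k + 1)) x) = (((k : ℂ) + 1) * (c - k)) • (f ^ k) x := by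
  induction k with
  | zero =>
    have := hef x
    rw [hex] at this
    simp at this
    simp [this, hx]
  | succ k ih =>
    obtain ⟨ih1, ih2⟩ := ih
    have h1 : h ((f ^ (k + 1)) x) = (c - 2 * ((k + 1 : ℕ) : ℂ)) • (f ^ (k + 1)) x := by
      rw [pow_succ', Module.End.mul_apply]
      have := hhf ((f ^ k) x)
      rw [ih1, map_smul, sub_eq_iff_eq_add] at this
      rw [this, ← add_smul]
      congr 1
      push_cast
      ring
    refine ⟨h1, ?_⟩
    rw [pow_succ', Module.End.mul_apply]
    have := hef ((f ^ (k + 1)) x)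
    have h5 : f ((f ^ k) x) = (f ^ (k + 1)) x := by rw [pow_succ', Module.End.mul_apply]
    rw [ih2, h1, map_smul, sub_eq_iff_eq_add, h5, ← add_smul] at this
    rw [this]
    congr 1
    push_cast
    ring

lemma sl2_aux_e_pow_f_pow (e f h : Module.End ℂ V)
    (hef : ∀ x, e (f x) - f (e x) = h x) (hhf : ∀ x, h (f x) - f (h x) = (-2 : ℂ) • f x)
    (x : V) (c : ℤ) (hex : e x = 0) (hx : h x = (c : ℂ) • x) (k : ℕ) (hk : (k : ℤ) ≤ c) :
    ∃ a : ℂ, a ≠ 0 ∧ (e ^ k) ((f ^ k) x) = a • x := by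
  induction k with
  | zero => exact ⟨1, one_ne_zero, by simp⟩
  | succ k ih =>
    obtain ⟨a, ha, h1⟩ := ih (by push_cast at hk; omega)
    refine ⟨((k : ℂ) + 1) * (c - k) * a, ?_, ?_⟩
    · refine mul_ne_zero (mul_ne_zero (by exact_mod_cast k.succ_ne_zero) ?_) ha
      rw [sub_ne_zero]
      push_cast at hk
      have : c ≠ (k : ℤ) := by omega
      exact_mod_cast this
    · rw [pow_succ e, Module.End.mul_apply, (sl2_aux_e_f_pow e f h hef hhf x c hex hx k).2,
        map_smul, h1, smul_smul]

lemma sl2_aux_surj (e f h : Module.End ℂ V)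
    (hef : ∀ x, e (f x) - f (e x) = h x) (hhf : ∀ x, h (f x) - f (h x) = (-2 : ℂ) • f x)
    (hhe : ∀ x, h (e x) - e (h x) = (2 : ℂ) • e x)
    (W : Submodule ℂ V) (hWe : ∀ x ∈ W, e x ∈ W) (hWf : ∀ x ∈ W, f x ∈ W)
    (w : ℤ) (hw : 0 < w) (N : ℕ) : ∀ u ∈ W, h u = (w : ℂ) • u → (e ^ N) u = 0 →
      ∃ v ∈ W, h v = ((w : ℂ) - 2) • v ∧ e v = u := by
  have hWfk : ∀ (k : ℕ) (x : V), x ∈ W → (f ^ k) x ∈ W := by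
    intro k x hx
    induction k with
    | zero => simpa
    | succ k ih => rw [pow_succ', Module.End.mul_apply]; exact hWf _ ih
  have hWek : ∀ (k : ℕ) (x : V), x ∈ W → (e ^ k) x ∈ W := by
    intro k x hx
    induction k with
    | zero => simpa
    | succ k ih => rw [pow_succ', Module.End.mul_apply]; exact hWe _ ih
  have hek : ∀ (k : ℕ) (x : V), h x = (w : ℂ) • x →
      h ((e ^ k) x) = ((w : ℂ) + 2 * k) • (e ^ k) x := by
    intro k x hx
    induction k with
    | zero => simpa
    | succ k ih =>
      rw [pow_succ', Module.End.mul_apply]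
      have := hhe ((e ^ k) x)
      rw [ih, map_smul, sub_eq_iff_eq_add] at this
      rw [this, ← add_smul]
      congr 1
      push_cast
      ring
  induction N with
  | zero =>
    intro u hu hu1 hu2
    simp at hu2
    exact ⟨0, W.zero_mem, by simp, by simp [hu2]⟩
  | succ N ih =>
    intro u hu hu1 hu2
    have hex : e ((e ^ N) u) = 0 := by rw [← Module.End.mul_apply, ← pow_succ', hu2]
    have hx : h ((e ^ N) u) = ((w + 2 * N : ℤ) : ℂ) • (e ^ N) u := by
      rw [hek N u hu1]; push_cast; rfl
    obtain ⟨a, ha, h1⟩ := sl2_aux_e_pow_f_pow e f h hef hhf _ _ hex hx (N + 1)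
      (by push_cast; omega)
    have hy := (sl2_aux_e_f_pow e f h hef hhf _ _ hex hx (N + 1)).1
    have hyW := hWfk (N + 1) _ (hWek N u hu)
    set y := (f ^ (N + 1)) ((e ^ N) u) with hydef
    have hy' : h y = ((w : ℂ) - 2) • y := by
      rw [hy]; congr 1; push_cast; ring
    have hey : h (e y) = (w : ℂ) • e y := by
      have := hhe y
      rw [hy', map_smul, sub_eq_iff_eq_add] at this
      rw [this, ← add_smul]
      congr 1
      ring
    obtain ⟨v, hv, hv1, hv2⟩ := ih (u - a⁻¹ • e y)
      (W.sub_mem hu (W.smul_mem _ (hWe _ hyW)))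
      (by rw [map_sub, map_smul, hu1, hey, smul_sub, smul_comm])
      (by
        rw [map_sub, map_smul, ← Module.End.mul_apply, ← pow_succ, h1, smul_smul,
          inv_mul_cancel₀ ha, one_smul, sub_self])
    refine ⟨v + a⁻¹ • y, W.add_mem hv (W.smul_mem _ hyW), ?_, ?_⟩
    · rw [map_add, map_smul, hv1, hy', smul_add, smul_comm]
    · rw [map_add, map_smul, hv2]; abel

end Abstract

section Diag

variable {σ : Type*} [Fintype σ]

noncomputable def diagDer (c : σ → ℂ) :
    Derivation ℂ (MvPolynomial σ ℂ) (MvPolynomial σ ℂ) :=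
  mkDerivation ℂ (fun x => c x • X x)

lemma diagDer_monomial (c : σ → ℂ) (α : σ →₀ ℕ) (r : ℂ) :
    diagDer c (monomial α r) = (∑ x, c x * α x) • monomial α r := by
  classical
  rw [diagDer, mkDerivation_monomial, Finsupp.sum_fintype _ _ (by simp), Finset.sum_smul,
    Finset.smul_sum]
  refine Finset.sum_congr rfl fun x _ => ?_
  by_cases hx : α x = 0
  · simp [hx]
  · have h1 : (α - Finsupp.single x 1) + Finsupp.single x 1 = α := by
      ext y
      by_cases hy : y = x
      · subst hy; simp; omega
      · simp [Finsupp.single_apply, Ne.symm hy]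
    rw [smul_eq_mul, mul_smul_comm, X, monomial_mul, h1]
    simp only [smul_monomial]
    congr 1
    simp
    ring

lemma coeff_diagDer (c : σ → ℂ) (f : MvPolynomial σ ℂ) (α : σ →₀ ℕ) :
    coeff α (diagDer c f) = (∑ x, c x * α x) * coeff α f := by
  classical
  induction f using MvPolynomial.induction_on' with
  | monomial β r =>
    rw [diagDer_monomial, coeff_smul, coeff_monomial]
    split_ifs with h
    · subst h; rfl
    · simp
  | add p q hp hq => rw [map_add, coeff_add, hp, hq, coeff_add, mul_add]

lemma diagDer_eq_smul_iff (c : σ → ℂ) (f : MvPolynomial σ ℂ) (a : ℂ) :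
    diagDer c f = a • f ↔ ∀ α ∈ f.support, (∑ x, c x * α x) = a := by
  rw [MvPolynomial.ext_iff]
  refine forall_congr' fun α => ?_
  rw [coeff_diagDer, coeff_smul, smul_eq_mul, mem_support_iff]
  constructor
  · intro h h0
    exact mul_right_cancel₀ h0 h
  · intro h
    by_cases h0 : coeff α f = 0
    · simp [h0]
    · rw [h h0]

end Diag

section Concrete

variable {n : ℕ} {d : Fin n → ℕ}

lemma E_eq_diag : E n d = diagDer (fun x => (d x.1 : ℂ) - 2 * (x.2.1 : ℂ)) := rfl

noncomputable def Gr (k : Fin n) :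
    Derivation ℂ (MvPolynomial (Idx n d) ℂ) (MvPolynomial (Idx n d) ℂ) :=
  diagDer (fun x => if x.1 = k then 1 else 0)

lemma D1_X (x : Idx n d) : D1 n d (X x) = if h : x.2.1 = 0 then 0
    else (x.2.1 : ℂ) • X ⟨x.1, ⟨x.2.1 - 1, by have := x.2.isLt; omega⟩⟩ := by
  rw [D1, mkDerivation_X]

lemma D2_X (x : Idx n d) : D2 n d (X x) = if h : x.2.1 = d x.1 then 0
    else ((d x.1 - x.2.1 : ℕ) : ℂ) • X ⟨x.1, ⟨x.2.1 + 1, by have := x.2.isLt; omega⟩⟩ := by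
  rw [D2, mkDerivation_X]

lemma diag_X (c : Idx n d → ℂ) (x : Idx n d) : diagDer c (X x) = c x • X x := by
  rw [diagDer, mkDerivation_X]

lemma Gr_D1 (k : Fin n) (p : MvPolynomial (Idx n d) ℂ) :
    Gr k (D1 n d p) - D1 n d (Gr k p) = 0 := by
  have : ⁅Gr (d := d) k, D1 n d⁆ = 0 := by
    apply MvPolynomial.derivation_ext
    intro x
    rw [Derivation.commutator_apply, Gr, diag_X, D1_X, Derivation.map_smul, D1_X]
    split_ifs <;> simp_all [diag_X]
  rw [← Derivation.commutator_apply, this]; rfl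

lemma Gr_D2 (k : Fin n) (p : MvPolynomial (Idx n d) ℂ) :
    Gr k (D2 n d p) - D2 n d (Gr k p) = 0 := by
  have : ⁅Gr (d := d) k, D2 n d⁆ = 0 := by
    apply MvPolynomial.derivation_ext
    intro x
    rw [Derivation.commutator_apply, Gr, diag_X, D2_X, Derivation.map_smul, D2_X]
    split_ifs <;> simp_all [diag_X]
  rw [← Derivation.commutator_apply, this]; rfl

lemma E_D1 (p : MvPolynomial (Idx n d) ℂ) :
    E n d (D1 n d p) - D1 n d (E n d p) = (2 : ℂ) • D1 n d p := by
  have : ⁅E n d, D1 n d⁆ = (2 : ℂ) • D1 n d := by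
    apply MvPolynomial.derivation_ext
    intro x
    rw [Derivation.commutator_apply, Derivation.smul_apply, E_eq_diag, diag_X, Derivation.map_smul, D1_X]
    split_ifs with h
    · simp
    · rw [Derivation.map_smul, diag_X]
      simp only [smul_smul]
      rw [← sub_smul]
      congr 1
      rw [Nat.cast_sub (by omega)]
      push_cast
      ring
  rw [← Derivation.commutator_apply, this]; rfl

lemma E_D2 (p : MvPolynomial (Idx n d) ℂ) :
    E n d (D2 n d p) - D2 n d (E n d p) = (-2 : ℂ) • D2 n d p := by
  have : ⁅E n d, D2 n d⁆ = (-2 : ℂ) • D2 n d := by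
    apply MvPolynomial.derivation_ext
    intro x
    rw [Derivation.commutator_apply, Derivation.smul_apply, E_eq_diag, diag_X, Derivation.map_smul, D2_X]
    split_ifs with h
    · simp
    · rw [Derivation.map_smul, diag_X]
      simp only [smul_smul]
      rw [← sub_smul]
      congr 1
      push_cast
      ring
  rw [← Derivation.commutator_apply, this]; rfl

lemma D1_D2 (p : MvPolynomial (Idx n d) ℂ) :
    D1 n d (D2 n d p) - D2 n d (D1 n d p) = E n d p := by
  have : ⁅D1 n d, D2 n d⁆ = E n d := by
    apply MvPolynomial.derivation_ext
    rintro ⟨k, j, hj⟩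
    rw [Derivation.commutator_apply, E_eq_diag, diag_X]
    have e1 : D1 n d (D2 n d (X ⟨k, j, hj⟩)) =
        (((d k : ℂ) - j) * (j + 1)) • X ⟨k, j, hj⟩ := by
      rw [D2_X]
      split_ifs with h
      · dsimp only at h
        simp [h]
      · dsimp only at h ⊢
        rw [Derivation.map_smul, D1_X, dif_neg (by simp), smul_smul, Nat.cast_sub (by omega)]
        simp
    have e2 : D2 n d (D1 n d (X ⟨k, j, hj⟩)) =
        ((j : ℂ) * (d k - j + 1)) • X ⟨k, j, hj⟩ := by
      rw [D1_X]
      split_ifs with h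
      · dsimp only at h
        simp [h]
      · dsimp only at h ⊢
        rw [Derivation.map_smul, D2_X, dif_neg (by dsimp only; omega), smul_smul]
        dsimp only
        have h3 : d k - (j - 1) = d k - j + 1 := by omega
        have h4 : j - 1 + 1 = j := by omega
        simp only [h3, h4]
        rw [Nat.cast_add, Nat.cast_sub (by omega)]
        simp
    rw [e1, e2, ← sub_smul]
    congr 1
    ring
  rw [← Derivation.commutator_apply, this]

lemma mem_mdeg_iff (m : Fin n → ℕ) (p : MvPolynomial (Idx n d) ℂ) :
    p ∈ mdeg n d m ↔ ∀ k, Gr k p = (m k : ℂ) • p := by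
  simp only [Gr, diagDer_eq_smul_iff]
  rw [forall_comm]
  refine forall_congr' fun α => ?_
  rw [forall_comm]
  refine forall_congr' fun k => forall_congr' fun _ => ?_
  rw [Fintype.sum_sigma, Finset.sum_eq_single k]
  · simp only [if_true, one_mul]
    exact_mod_cast Iff.rfl
  · intro b _ hb
    simp [hb]
  · simp

lemma D1_mem_mdeg (m : Fin n → ℕ) (p : MvPolynomial (Idx n d) ℂ) (hp : p ∈ mdeg n d m) :
    D1 n d p ∈ mdeg n d m := by
  rw [mem_mdeg_iff] at *
  intro k
  rw [sub_eq_zero.1 (Gr_D1 k p), hp, Derivation.map_smul]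

lemma D2_mem_mdeg (m : Fin n → ℕ) (p : MvPolynomial (Idx n d) ℂ) (hp : p ∈ mdeg n d m) :
    D2 n d p ∈ mdeg n d m := by
  rw [mem_mdeg_iff] at *
  intro k
  rw [sub_eq_zero.1 (Gr_D2 k p), hp, Derivation.map_smul]

/-- exponents -/
def Sset (n : ℕ) (d : Fin n → ℕ) (m : Fin n → ℕ) (i : ℤ) : Set (Idx n d →₀ ℕ) :=
  {α | (∀ k : Fin n, (∑ j : Fin (d k + 1), α ⟨k, j⟩) = m k) ∧
    (∑ k : Fin n, ∑ j : Fin (d k + 1),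
      ((d k : ℤ) - 2 * (j : ℕ)) * (α ⟨k, j⟩ : ℤ)) = i}

lemma Sset_finite (m : Fin n → ℕ) (i : ℤ) : (Sset n d m i).Finite := by
  refine (Set.finite_Iic (Finsupp.equivFunOnFinite.symm fun x : Idx n d => m x.1)).subset ?_
  rintro α ⟨hα, -⟩ ⟨k, j⟩
  simp only [Finsupp.equivFunOnFinite_symm_apply_apply]
  rw [← hα k]
  exact Finset.single_le_sum (f := fun j => α ⟨k, j⟩) (fun _ _ => Nat.zero_le _)
    (Finset.mem_univ j)

lemma Sset_card (m : Fin n → ℕ) (i : ℤ) : Nat.card (Sset n d m i) = omegaCount n d m i := by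
  refine Nat.card_congr (Equiv.subtypeEquiv Finsupp.equivFunOnFinite ?_)
  intro α
  rfl

/-- weight space -/
noncomputable def Vw (n : ℕ) (d : Fin n → ℕ) (m : Fin n → ℕ) (i : ℤ) :
    Submodule ℂ (MvPolynomial (Idx n d) ℂ) :=
  mdeg n d m ⊓ Module.End.eigenspace ((E n d).toLinearMap) (i : ℂ)

lemma mem_Vw (m : Fin n → ℕ) (i : ℤ) (p : MvPolynomial (Idx n d) ℂ) :
    p ∈ Vw n d m i ↔ p ∈ mdeg n d m ∧ E n d p = (i : ℂ) • p := by
  rw [Vw, Submodule.mem_inf, Module.End.mem_eigenspace_iff]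
  rfl

lemma Vw_eq (m : Fin n → ℕ) (i : ℤ) : Vw n d m i = restrictSupport ℂ (Sset n d m i) := by
  ext p
  rw [mem_Vw, mem_restrictSupport_iff, E_eq_diag, diagDer_eq_smul_iff]
  have : ∀ α : Idx n d →₀ ℕ, (∑ x : Idx n d, ((d x.1 : ℂ) - 2 * (x.2.1 : ℂ)) * α x = (i : ℂ)) ↔
      (∑ k : Fin n, ∑ j : Fin (d k + 1),
      ((d k : ℤ) - 2 * (j : ℕ)) * (α ⟨k, j⟩ : ℤ)) = i := by
    intro α
    rw [Fintype.sum_sigma]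
    exact_mod_cast Iff.rfl
  simp only [this]
  constructor
  · rintro ⟨h1, h2⟩ α hα
    exact ⟨h1 α hα, h2 α hα⟩
  · intro h
    exact ⟨fun α hα => (h hα).1, fun α hα => (h hα).2⟩

lemma Vw_finite (m : Fin n → ℕ) (i : ℤ) : Module.Finite ℂ (Vw n d m i) := by
  rw [Vw_eq]
  have := (Sset_finite (d := d) m i).to_subtype
  exact Module.Finite.of_basis (basisRestrictSupport ℂ (Sset n d m i))

lemma Vw_finrank (m : Fin n → ℕ) (i : ℤ) :
    Module.finrank ℂ (Vw n d m i) = omegaCount n d m i := by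
  rw [Vw_eq, Module.finrank_eq_nat_card_basis (basisRestrictSupport ℂ (Sset n d m i)), Sset_card]

lemma Vw_eq_bot (m : Fin n → ℕ) (i : ℤ) (hi : ∑ k, (d k : ℤ) * m k < i) (p)
    (hp : p ∈ Vw n d m i) : p = 0 := by
  have : Sset n d m i = ∅ := by
    rw [Set.eq_empty_iff_forall_notMem]
    rintro α ⟨h1, h2⟩
    apply hi.not_ge
    rw [← h2]
    refine Finset.sum_le_sum fun k _ => ?_
    rw [← h1 k]
    push_cast
    rw [Finset.mul_sum]
    refine Finset.sum_le_sum fun j _ => ?_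
    refine mul_le_mul_of_nonneg_right ?_ (by positivity)
    omega
  rw [Vw_eq, this, mem_restrictSupport_iff] at hp
  simpa using hp

lemma D1_mem_Vw (m : Fin n → ℕ) (i : ℤ) (p) (hp : p ∈ Vw n d m i) :
    D1 n d p ∈ Vw n d m (i + 2) := by
  rw [mem_Vw] at *
  refine ⟨D1_mem_mdeg _ _ hp.1, ?_⟩
  have := E_D1 p
  rw [hp.2, Derivation.map_smul, sub_eq_iff_eq_add] at this
  rw [this, ← add_smul]
  congr 1
  push_cast
  ring

lemma D1_pow_mem_Vw (m : Fin n → ℕ) (i : ℤ) (p) (hp : p ∈ Vw n d m i) (N : ℕ) :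
    ((D1 n d).toLinearMap ^ N) p ∈ Vw n d m (i + 2 * N) := by
  induction N with
  | zero => simpa
  | succ N ih =>
    rw [pow_succ', Module.End.mul_apply]
    have := D1_mem_Vw _ _ _ ih
    have h2 : i + 2 * ((N + 1 : ℕ) : ℤ) = i + 2 * N + 2 := by push_cast; ring
    rw [h2]
    exact this

lemma D1_surj (m : Fin n → ℕ) (i : ℤ) (hi : 0 ≤ i) (u) (hu : u ∈ Vw n d m (i + 2)) :
    ∃ v ∈ Vw n d m i, D1 n d v = u := by
  obtain ⟨N, hN⟩ : ∃ N : ℕ, ∑ k, (d k : ℤ) * m k < i + 2 + 2 * N :=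
    ⟨(∑ k, (d k : ℤ) * m k).toNat, by omega⟩
  have h0 := Vw_eq_bot _ _ hN _ (D1_pow_mem_Vw m _ u hu N)
  rw [mem_Vw] at hu
  obtain ⟨v, h1, h2, h3⟩ := sl2_aux_surj (D1 n d).toLinearMap (D2 n d).toLinearMap
    (E n d).toLinearMap D1_D2 E_D2 E_D1 (mdeg n d m) (D1_mem_mdeg m) (D2_mem_mdeg m)
    (i + 2) (by omega) N u hu.1 hu.2 h0
  refine ⟨v, ?_, h3⟩
  rw [mem_Vw]
  refine ⟨h1, ?_⟩
  refine h2.trans ?_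
  congr 1
  push_cast
  ring

end Concrete

/-- For every multidegree `m ∈ ℕ^n` and integer `i ≥ 0`, the space of polynomials of
multidegree `m` with `D1 f = 0` and `E f = i • f` has dimension
`ω_d(m; i) - ω_d(m; i + 2)`. -/
theorem dim_semiinvariants_eq_omega_sub_omega
    (n : ℕ) (hn : 1 ≤ n) (d : Fin n → ℕ) (hd : ∀ k, 1 ≤ d k)
    (m : Fin n → ℕ) (i : ℤ) (hi : 0 ≤ i) :
    (Module.finrank ℂ ↥(mdeg n d m ⊓ LinearMap.ker (D1 n d).toLinearMap ⊓
        Module.End.eigenspace ((E n d).toLinearMap) (i : ℂ)) : ℤ) =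
      (omegaCount n d m i : ℤ) - (omegaCount n d m (i + 2) : ℤ) := by
  have hle : mdeg n d m ⊓ LinearMap.ker (D1 n d).toLinearMap ⊓
        Module.End.eigenspace ((E n d).toLinearMap) (i : ℂ) ≤ Vw n d m i := by
    rintro p ⟨⟨h1, h2⟩, h3⟩
    exact ⟨h1, h3⟩
  have hfin := Vw_finite (d := d) m i
  let φ : Vw n d m i →ₗ[ℂ] Vw n d m (i + 2) :=
    (D1 n d).toLinearMap.restrict (D1_mem_Vw m i)
  have hφ : LinearMap.range φ = ⊤ := by
    rw [LinearMap.range_eq_top]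
    rintro ⟨u, hu⟩
    obtain ⟨v, hv, h⟩ := D1_surj m i hi u hu
    exact ⟨⟨v, hv⟩, Subtype.ext h⟩
  have hker : LinearMap.ker φ = Submodule.comap (Vw n d m i).subtype
      (mdeg n d m ⊓ LinearMap.ker (D1 n d).toLinearMap ⊓
        Module.End.eigenspace ((E n d).toLinearMap) (i : ℂ)) := by
    ext ⟨p, hp⟩
    rw [LinearMap.mem_ker, Submodule.mem_comap]
    constructor
    · intro h
      exact ⟨⟨hp.1, congrArg Subtype.val h⟩, hp.2⟩
    · rintro ⟨⟨_, h⟩, _⟩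
      exact Subtype.ext h
  have h1 := LinearMap.finrank_range_add_finrank_ker φ
  rw [hφ, finrank_top, hker, (Submodule.comapSubtypeEquivOfLe hle).finrank_eq, Vw_finrank,
    Vw_finrank] at h1
  omega
end

section
/- For every multidegree m ∈ ℕ^n and every integer i ≥ 0, let W_s denote the ℂ-vector space of polynomials f ∈ R of multidegree m satisfying D1(f) = 0 and D2^{s+1}(f) = 0 (with W_{−1} := {0}). Then dim_ℂ W_i − dim_ℂ W_{i−1} = ω_d(m;i) − ω_d(m;i+2); that is, the number of linearly independent joint semi-invariants of multidegree m and order exactly i equals ω_d(m;i) − ω_d(m;i+2). -/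
open MvPolynomial

/-- `W s` (for `s ≥ -1`, reindexed as `W s = semiInv (s+1)`): the space of polynomials of
multidegree `m` with `D1 f = 0` and `D2^{s} f = 0`. Thus `semiInv 0 = {0}` (`W_{-1}`) and
`semiInv (i+1) = W_i`. -/
noncomputable def semiInv (n : ℕ) (d : Fin n → ℕ) (m : Fin n → ℕ) (s : ℕ) :
    Submodule ℂ (MvPolynomial (Idx n d) ℂ) :=
  mdeg n d m ⊓ LinearMap.ker (D1 n d).toLinearMap ⊓
    LinearMap.ker ((D2 n d).toLinearMap ^ s)

section aux

open Finsupp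

theorem mkDer_homog {σ M : Type*} [AddCommGroup M] (w : σ → M) (c : M)
    (g : σ → MvPolynomial σ ℂ) (hg : ∀ x, IsWeightedHomogeneous w (g x) (w x + c))
    {p : M} {φ : MvPolynomial σ ℂ} (hφ : IsWeightedHomogeneous w φ p) :
    IsWeightedHomogeneous w (mkDerivation ℂ g φ) (p + c) := by
  rw [φ.as_sum, map_sum]
  refine IsWeightedHomogeneous.sum _ _ _ fun s hs => ?_
  have hsw := hφ (MvPolynomial.mem_support_iff.1 hs)
  rw [mkDerivation_monomial, ← mem_weightedHomogeneousSubmodule]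
  refine Submodule.smul_mem _ _ (Submodule.sum_mem _ fun x hx => ?_)
  have hle : Finsupp.single x 1 ≤ s := by
    rw [Finsupp.single_le_iff]
    have := Finsupp.mem_support_iff.1 hx
    omega
  rw [mem_weightedHomogeneousSubmodule]
  simp only [smul_eq_mul]
  have h1 : weight w (s - Finsupp.single x 1) + w x = p := by
    rw [← hsw]
    conv_rhs => rw [← tsub_add_cancel_of_le hle]
    rw [map_add, Finsupp.weight_single]
    simp
  have := (isWeightedHomogeneous_monomial w (s - Finsupp.single x 1) ((s x : ℕ) : ℂ) rfl).mul (hg x)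
  rwa [← add_assoc, h1] at this

theorem comp_comm {σ M : Type*} [AddCommGroup M] (w : σ → M) (c : M)
    (D : MvPolynomial σ ℂ →ₗ[ℂ] MvPolynomial σ ℂ)
    (hD : ∀ p φ, IsWeightedHomogeneous w φ p → IsWeightedHomogeneous w (D φ) (p + c))
    (p : M) (φ : MvPolynomial σ ℂ) :
    weightedHomogeneousComponent w (p + c) (D φ) = D (weightedHomogeneousComponent w p φ) := by
  classical
  rw [φ.as_sum]
  simp only [map_sum]
  refine Finset.sum_congr rfl fun s _ => ?_
  have h1 : IsWeightedHomogeneous w (monomial s (coeff s φ)) (weight w s) :=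
    isWeightedHomogeneous_monomial w s _ rfl
  rw [weightedHomogeneousComponent_of_mem (hD _ _ h1), weightedHomogeneousComponent_of_mem h1]
  simp only [add_left_inj]
  split_ifs <;> simp

variable (n : ℕ) (d : Fin n → ℕ)

def wt (x : Idx n d) : ℤ := (d x.1 : ℤ) - 2 * (x.2 : ℕ)

def gr (x : Idx n d) : Fin n → ℤ := Pi.single x.1 1

theorem D1_homog {M : Type*} [AddCommGroup M] (w : Idx n d → M) (c : M)
    (h : ∀ (x y : Idx n d), x.1 = y.1 → y.2.1 + 1 = x.2.1 → w y = w x + c)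
    (p : M) (φ : MvPolynomial (Idx n d) ℂ) (hφ : IsWeightedHomogeneous w φ p) :
    IsWeightedHomogeneous w ((D1 n d).toLinearMap φ) (p + c) := by
  refine mkDer_homog w c _ (fun x => ?_) hφ
  split_ifs with h0
  · exact isWeightedHomogeneous_zero _ _ _
  · rw [← mem_weightedHomogeneousSubmodule]
    refine Submodule.smul_mem _ _ ?_
    rw [mem_weightedHomogeneousSubmodule, ← h x ⟨x.1, ⟨x.2.1 - 1, by have := x.2.isLt; omega⟩⟩ rfl (by simp; omega)]
    exact isWeightedHomogeneous_X _ _ _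

theorem D2_homog {M : Type*} [AddCommGroup M] (w : Idx n d → M) (c : M)
    (h : ∀ (x y : Idx n d), x.1 = y.1 → y.2.1 = x.2.1 + 1 → w y = w x + c)
    (p : M) (φ : MvPolynomial (Idx n d) ℂ) (hφ : IsWeightedHomogeneous w φ p) :
    IsWeightedHomogeneous w ((D2 n d).toLinearMap φ) (p + c) := by
  refine mkDer_homog w c _ (fun x => ?_) hφ
  split_ifs with h0
  · exact isWeightedHomogeneous_zero _ _ _
  · rw [← mem_weightedHomogeneousSubmodule]
    refine Submodule.smul_mem _ _ ?_
    rw [mem_weightedHomogeneousSubmodule, ← h x ⟨x.1, ⟨x.2.1 + 1, by have := x.2.isLt; omega⟩⟩ rfl (by simp)]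
    exact isWeightedHomogeneous_X _ _ _

theorem D1_wt (p : ℤ) (φ : MvPolynomial (Idx n d) ℂ) (hφ : IsWeightedHomogeneous (wt n d) φ p) :
    IsWeightedHomogeneous (wt n d) ((D1 n d).toLinearMap φ) (p + 2) :=
  D1_homog n d _ 2 (fun x y h1 h2 => by have h3 := congrArg d h1; simp only [wt]; omega) p φ hφ

theorem D2_wt (p : ℤ) (φ : MvPolynomial (Idx n d) ℂ) (hφ : IsWeightedHomogeneous (wt n d) φ p) :
    IsWeightedHomogeneous (wt n d) ((D2 n d).toLinearMap φ) (p + (-2)) :=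
  D2_homog n d _ (-2) (fun x y h1 h2 => by have h3 := congrArg d h1; simp only [wt]; omega) p φ hφ

theorem weight_gr (α : Idx n d →₀ ℕ) (k : Fin n) :
    weight (gr n d) α k = ((∑ j : Fin (d k + 1), α ⟨k, j⟩ : ℕ) : ℤ) := by
  rw [Finsupp.weight_apply, Finsupp.sum_fintype _ _ (by simp), Fintype.sum_sigma]
  simp only [gr, Finset.sum_apply, Pi.smul_apply]
  rw [Finset.sum_eq_single k]
  · simp
  · intro b _ hb
    simp [Pi.single_apply, hb.symm]
  · simp

theorem weight_wt (α : Idx n d →₀ ℕ) :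
    weight (wt n d) α = ∑ k : Fin n, ∑ j : Fin (d k + 1),
      ((d k : ℤ) - 2 * (j : ℕ)) * (α ⟨k, j⟩ : ℤ) := by
  rw [Finsupp.weight_apply, Finsupp.sum_fintype _ _ (by simp), Fintype.sum_sigma]
  simp [wt, mul_comm]

theorem mem_mdeg (m : Fin n → ℕ) (φ : MvPolynomial (Idx n d) ℂ) :
    φ ∈ mdeg n d m ↔ IsWeightedHomogeneous (gr n d) φ (fun k => (m k : ℤ)) := by
  refine forall_congr' fun α => ?_
  rw [MvPolynomial.mem_support_iff]
  refine imp_congr_right fun _ => ?_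
  rw [funext_iff]
  simp only [weight_gr, Nat.cast_inj]

theorem D1_mdeg (m : Fin n → ℕ) {φ} (h : φ ∈ mdeg n d m) : (D1 n d).toLinearMap φ ∈ mdeg n d m := by
  rw [mem_mdeg] at *
  simpa using D1_homog n d (gr n d) 0 (fun x y h1 _ => by simp [gr, h1]) _ _ h

theorem D2_mdeg (m : Fin n → ℕ) {φ} (h : φ ∈ mdeg n d m) : (D2 n d).toLinearMap φ ∈ mdeg n d m := by
  rw [mem_mdeg] at *
  simpa using D2_homog n d (gr n d) 0 (fun x y h1 _ => by simp [gr, h1]) _ _ h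

theorem comm_E : ⁅D1 n d, D2 n d⁆ = E n d := by
  apply derivation_ext
  rintro ⟨k, j, hj⟩
  rw [Derivation.commutator_apply]
  simp only [D1, D2, E, mkDerivation_X]
  by_cases h0 : j = 0 <;> by_cases h1 : j = d k
  · subst h0
    simp [← h1]
  · subst h0
    simp [mkDerivation_X, Ne.symm h1, eq_comm]
  · subst h1
    rw [dif_pos rfl, dif_neg h0]
    have : d k - 1 ≠ d k := by omega
    have h2 : d k - (d k - 1) = 1 := by omega
    have h3 : d k - 1 + 1 = d k := by omega
    simp only [map_zero, Derivation.map_smul, mkDerivation_X, this, dite_false, h2, h3, zero_sub, ← neg_smul, smul_smul]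
    congr 1
    push_cast; ring
  · have h2 : j - 1 ≠ d k := by omega
    have h3 : j - 1 + 1 = j := by omega
    simp only [h0, h1, dite_false, Derivation.map_smul, mkDerivation_X, h2, h3, smul_smul]
    simp only [Nat.add_sub_cancel, Nat.add_eq_zero_iff, one_ne_zero, and_false, dite_false, smul_smul, ← sub_smul]
    congr 1
    rw [Nat.cast_sub (by omega), Nat.cast_sub (by omega), Nat.cast_sub (by omega)]
    push_cast; ring

theorem E_wt (p : ℤ) (φ : MvPolynomial (Idx n d) ℂ) (hφ : IsWeightedHomogeneous (wt n d) φ p) :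
    E n d φ = (p : ℂ) • φ := by
  rw [φ.as_sum, map_sum, Finset.smul_sum]
  refine Finset.sum_congr rfl fun s hs => ?_
  have hsw := hφ (MvPolynomial.mem_support_iff.1 hs)
  rw [E, mkDerivation_monomial, ← hsw]
  have : ∀ x ∈ s.support, (monomial (s - Finsupp.single x 1) ((s x : ℕ) : ℂ)) •
      (((d x.1 : ℂ) - 2 * (x.2.1 : ℂ)) • (X x : MvPolynomial (Idx n d) ℂ))
      = (((s x) • wt n d x : ℤ) : ℂ) • monomial s 1 := by
    intro x hx
    have hle : Finsupp.single x 1 ≤ s := by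
      rw [Finsupp.single_le_iff]
      have := Finsupp.mem_support_iff.1 hx
      omega
    rw [smul_eq_mul, mul_smul_comm, X, monomial_mul, tsub_add_cancel_of_le hle, smul_monomial, smul_monomial]
    congr 1
    simp [wt, mul_comm]
  rw [Finsupp.sum, Finset.sum_congr rfl this, ← Finset.sum_smul, ← Int.cast_sum, Finsupp.weight_apply, Finsupp.sum, smul_smul,
    smul_monomial, smul_monomial]
  simp [mul_comm]

theorem bracket (p : ℤ) (φ : MvPolynomial (Idx n d) ℂ) (hφ : IsWeightedHomogeneous (wt n d) φ p) :
    (D1 n d).toLinearMap ((D2 n d).toLinearMap φ) =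
      (D2 n d).toLinearMap ((D1 n d).toLinearMap φ) + (p : ℂ) • φ := by
  rw [← E_wt n d p φ hφ, ← comm_E, Derivation.commutator_apply]
  simp

end aux

section aux2

open Finsupp

theorem rank_null {P : Type*} [AddCommGroup P] [Module ℂ P] (A B C : Submodule ℂ P)
    [FiniteDimensional ℂ A] (T : P →ₗ[ℂ] P) (hBA : B ≤ A)
    (hk : ∀ x ∈ A, T x = 0 ↔ x ∈ B) (hr : A.map T = C) :
    Module.finrank ℂ C + Module.finrank ℂ B = Module.finrank ℂ A := by
  have h := LinearMap.finrank_range_add_finrank_ker (T.domRestrict A)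
  have h1 : LinearMap.range (T.domRestrict A) = C := by
    rw [← hr, LinearMap.range_domRestrict]
  have h2 : LinearMap.ker (T.domRestrict A) = B.comap A.subtype := by
    ext ⟨x, hx⟩
    simpa using hk x hx
  rw [h1, h2, (Submodule.comapSubtypeEquivOfLe hBA).finrank_eq] at h
  exact h

variable (n : ℕ) (d : Fin n → ℕ) (m : Fin n → ℕ)

noncomputable def VV (j : ℤ) : Submodule ℂ (MvPolynomial (Idx n d) ℂ) :=
  mdeg n d m ⊓ weightedHomogeneousSubmodule ℂ (wt n d) j

theorem mdeg_fin : FiniteDimensional ℂ (mdeg n d m) := by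
  have h : mdeg n d m = restrictSupport ℂ {α | ∀ k, (∑ j : Fin (d k + 1), α ⟨k, j⟩) = m k} := by
    ext φ
    rw [mem_restrictSupport_iff]
    rfl
  rw [h]
  have hf : ({α | ∀ k, (∑ j : Fin (d k + 1), α ⟨k, j⟩) = m k} : Set (Idx n d →₀ ℕ)).Finite := by
    refine (Set.finite_Iic (Finsupp.equivFunOnFinite.symm fun x : Idx n d => m x.1)).subset ?_
    intro α hα x
    rw [Set.mem_ofPred_eq] at hα
    simp only [Finsupp.equivFunOnFinite_symm_apply_apply]
    rw [← hα x.1]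
    exact Finset.single_le_sum (f := fun j => α ⟨x.1, j⟩) (fun _ _ => Nat.zero_le _) (Finset.mem_univ x.2)
  have := hf.to_subtype
  exact Module.Finite.of_basis (basisRestrictSupport ℂ _)

theorem VV_fin (j : ℤ) : FiniteDimensional ℂ (VV n d m j) :=
  have := mdeg_fin n d m
  Submodule.finiteDimensional_of_le inf_le_left

theorem VV_finrank (j : ℤ) : Module.finrank ℂ (VV n d m j) = omegaCount n d m j := by
  have h : VV n d m j = restrictSupport ℂ {α | (∀ k, (∑ j : Fin (d k + 1), α ⟨k, j⟩) = m k) ∧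
      weight (wt n d) α = j} := by
    ext φ
    rw [mem_restrictSupport_iff]
    constructor
    · rintro ⟨h1, h2⟩ α hα
      exact ⟨h1 α hα, h2 (MvPolynomial.mem_support_iff.1 hα)⟩
    · intro h
      exact ⟨fun α hα => (h hα).1, fun α hα => (h (MvPolynomial.mem_support_iff.2 hα)).2⟩
  rw [h, Module.finrank_eq_nat_card_basis (basisRestrictSupport ℂ _), omegaCount]
  refine Nat.card_congr (Equiv.subtypeEquiv Finsupp.equivFunOnFinite fun α => ?_)
  show ((∀ k, (∑ j : Fin (d k + 1), α ⟨k, j⟩) = m k) ∧ weight (wt n d) α = j) ↔ _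
  rw [weight_wt]
  rfl

theorem VV_big (j : ℤ) (hj : (∑ k, (d k * m k : ℤ)) < j) {φ} (hφ : φ ∈ VV n d m j) : φ = 0 := by
  by_contra h0
  obtain ⟨α, hα⟩ := Finset.nonempty_iff_ne_empty.2 (fun h => h0 (MvPolynomial.support_eq_empty.1 h))
  have h1 := hφ.1 α hα
  have h2 := hφ.2 (MvPolynomial.mem_support_iff.1 hα)
  rw [weight_wt] at h2
  have : (∑ k : Fin n, ∑ j : Fin (d k + 1),
      ((d k : ℤ) - 2 * (j : ℕ)) * (α ⟨k, j⟩ : ℤ)) ≤ ∑ k, (d k * m k : ℤ) := by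
    refine Finset.sum_le_sum fun k _ => ?_
    rw [← h1 k]
    push_cast
    rw [Finset.mul_sum]
    refine Finset.sum_le_sum fun j _ => ?_
    gcongr
    omega
  omega

theorem VV_small (j : ℤ) (hj : j < -(∑ k, (d k * m k : ℤ))) {φ} (hφ : φ ∈ VV n d m j) : φ = 0 := by
  by_contra h0
  obtain ⟨α, hα⟩ := Finset.nonempty_iff_ne_empty.2 (fun h => h0 (MvPolynomial.support_eq_empty.1 h))
  have h1 := hφ.1 α hα
  have h2 := hφ.2 (MvPolynomial.mem_support_iff.1 hα)
  rw [weight_wt] at h2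
  have : -(∑ k, (d k * m k : ℤ)) ≤ (∑ k : Fin n, ∑ j : Fin (d k + 1),
      ((d k : ℤ) - 2 * (j : ℕ)) * (α ⟨k, j⟩ : ℤ)) := by
    rw [← Finset.sum_neg_distrib]
    refine Finset.sum_le_sum fun k _ => ?_
    rw [← h1 k]
    push_cast
    rw [Finset.mul_sum, ← Finset.sum_neg_distrib]
    refine Finset.sum_le_sum fun j _ => ?_
    rw [← neg_mul]
    gcongr
    have := j.isLt
    omega
  omega

theorem VV_D1 (j : ℤ) {φ} (hφ : φ ∈ VV n d m j) : (D1 n d).toLinearMap φ ∈ VV n d m (j + 2) :=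
  ⟨D1_mdeg n d m hφ.1, D1_wt n d j φ hφ.2⟩

theorem VV_D2 (j : ℤ) {φ} (hφ : φ ∈ VV n d m j) : (D2 n d).toLinearMap φ ∈ VV n d m (j + (-2)) :=
  ⟨D2_mdeg n d m hφ.1, D2_wt n d j φ hφ.2⟩

theorem VV_D1_pow (j : ℤ) {φ} (hφ : φ ∈ VV n d m j) (t : ℕ) :
    ((D1 n d).toLinearMap ^ t) φ ∈ VV n d m (j + 2 * t) := by
  induction t with
  | zero => simpa using hφ
  | succ t ih =>
    rw [pow_succ', Module.End.mul_apply]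
    have := VV_D1 n d m _ ih
    convert this using 1
    push_cast; ring

theorem wt_D2_pow (j : ℤ) {φ} (hφ : IsWeightedHomogeneous (wt n d) φ j) (t : ℕ) :
    IsWeightedHomogeneous (wt n d) (((D2 n d).toLinearMap ^ t) φ) (j + t * (-2)) := by
  induction t with
  | zero => simpa using hφ
  | succ t ih =>
    rw [pow_succ', Module.End.mul_apply]
    have := D2_wt n d _ _ ih
    convert this using 1
    push_cast; ring

theorem mdeg_D2_pow {φ} (hφ : φ ∈ mdeg n d m) (t : ℕ) :
    ((D2 n d).toLinearMap ^ t) φ ∈ mdeg n d m := by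
  induction t with
  | zero => simpa using hφ
  | succ t ih =>
    rw [pow_succ', Module.End.mul_apply]
    exact D2_mdeg n d m ih

theorem D2_nilp (j : ℤ) {φ} (hφ : φ ∈ VV n d m j) : ∃ t : ℕ, ((D2 n d).toLinearMap ^ t) φ = 0 := by
  refine ⟨(∑ k, (d k * m k : ℤ)).toNat + j.toNat + 1, VV_small n d m _ ?_
    ⟨mdeg_D2_pow n d m hφ.1 _, wt_D2_pow n d j hφ.2 _⟩⟩
  push_cast
  omega

theorem prim_step (j : ℤ) {v : MvPolynomial (Idx n d) ℂ}
    (hv : IsWeightedHomogeneous (wt n d) v j)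
    (h1 : (D1 n d).toLinearMap v = 0) (s : ℕ) :
    (D1 n d).toLinearMap (((D2 n d).toLinearMap ^ (s + 1)) v) =
      (((s : ℂ) + 1) * ((j : ℂ) - s)) • ((D2 n d).toLinearMap ^ s) v := by
  induction s with
  | zero =>
    simp only [zero_add, pow_one, pow_zero, Module.End.one_apply]
    rw [bracket n d j v hv, h1]
    simp
  | succ s ih =>
    rw [pow_succ', Module.End.mul_apply, bracket n d _ _ (wt_D2_pow n d j hv (s + 1)), ih, map_smul,
      ← Module.End.mul_apply, ← pow_succ', ← add_smul]
    congr 1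
    push_cast; ring

theorem prim_wt (j : ℤ) {v : MvPolynomial (Idx n d) ℂ}
    (hv : IsWeightedHomogeneous (wt n d) v j)
    (h1 : (D1 n d).toLinearMap v = 0) (h0 : v ≠ 0) (s : ℕ)
    (hs : ((D2 n d).toLinearMap ^ s) v = 0) :
    ∃ t : ℕ, t < s ∧ j = t ∧ ((D2 n d).toLinearMap ^ (t + 1)) v = 0 := by
  classical
  have hex : ∃ s, ((D2 n d).toLinearMap ^ s) v = 0 := ⟨s, hs⟩
  have hm := Nat.find_spec hex
  have hle := Nat.find_min' hex hs
  have hmin := fun t => @Nat.find_min _ _ hex t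
  generalize Nat.find hex = r at *
  cases r with
  | zero => exact absurd (by simpa using hm) h0
  | succ t =>
    refine ⟨t, by omega, ?_, hm⟩
    have h2 := prim_step n d j hv h1 t
    rw [hm, map_zero, eq_comm, smul_eq_zero] at h2
    rcases h2 with h2 | h2
    · rcases mul_eq_zero.1 h2 with h3 | h3
      · exact absurd h3 (by exact_mod_cast Nat.succ_ne_zero t)
      · have := sub_eq_zero.1 h3
        exact_mod_cast this
    · exact absurd h2 (hmin t (by omega))

theorem inj_step (k : ℤ) (hk : 0 < k) {w} (hw : w ∈ VV n d m k)
    (h : (D1 n d).toLinearMap ((D2 n d).toLinearMap w) = 0) : w = 0 := by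
  by_contra h0
  have key : ∀ t : ℕ, ((D1 n d).toLinearMap ^ t) w ≠ 0 ∧ ∃ c : ℤ, 0 < c ∧
      (D2 n d).toLinearMap ((D1 n d).toLinearMap (((D1 n d).toLinearMap ^ t) w)) =
        (-c : ℂ) • ((D1 n d).toLinearMap ^ t) w := by
    intro t
    induction t with
    | zero =>
      refine ⟨by simpa using h0, k, hk, ?_⟩
      have := bracket n d k w hw.2
      rw [h] at this
      simp only [pow_zero, Module.End.one_apply]
      rw [neg_smul]
      exact eq_neg_of_add_eq_zero_left this.symm
    | succ t ih =>
      obtain ⟨h1, c, hc, h2⟩ := ih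
      have hne : ((D1 n d).toLinearMap ^ (t + 1)) w ≠ 0 := by
        rw [pow_succ', Module.End.mul_apply]
        intro h3
        rw [h3, map_zero, eq_comm, smul_eq_zero] at h2
        rcases h2 with h2 | h2
        · rw [neg_eq_zero, Int.cast_eq_zero] at h2
          omega
        · exact h1 h2
      refine ⟨hne, c + (k + 2 * (t + 1 : ℕ)), by positivity, ?_⟩
      have hb := bracket n d _ _ (VV_D1_pow n d m k hw (t + 1)).2
      have h4 := congrArg (D1 n d).toLinearMap h2
      rw [map_smul, ← Module.End.mul_apply (D1 n d).toLinearMap (_ ^ t), ← pow_succ'] at h4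
      rw [h4] at hb
      rw [eq_sub_of_add_eq hb.symm, ← sub_smul]
      congr 1
      push_cast; ring
  obtain ⟨t, ht⟩ : ∃ t : ℕ, (∑ k, (d k * m k : ℤ)) < t := ⟨(∑ k, (d k * m k : ℤ)).toNat + 1, by omega⟩
  exact (key t).1 (VV_big n d m _ (by omega) (VV_D1_pow n d m k hw t))

theorem surj_step (k : ℤ) (hk : 0 < k + 2) :
    (VV n d m k).map (D1 n d).toLinearMap = VV n d m (k + 2) := by
  apply le_antisymm
  · rintro _ ⟨x, hx, rfl⟩
    exact VV_D1 n d m k hx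
  · intro y hy
    have := VV_fin n d m (k + 2)
    have hmap : ∀ x ∈ VV n d m (k + 2),
        ((D1 n d).toLinearMap ∘ₗ (D2 n d).toLinearMap) x ∈ VV n d m (k + 2) := by
      intro x hx
      have := VV_D1 n d m _ (VV_D2 n d m _ hx)
      simpa using this
    have hinj : Function.Injective
        (((D1 n d).toLinearMap ∘ₗ (D2 n d).toLinearMap).restrict hmap) := by
      rw [← LinearMap.ker_eq_bot, LinearMap.ker_eq_bot']
      rintro ⟨x, hx⟩ h
      have h' := congrArg Subtype.val h
      exact Subtype.ext (inj_step n d m _ hk hx h')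
    obtain ⟨⟨x, hx⟩, hxy⟩ := LinearMap.surjective_of_injective hinj ⟨y, hy⟩
    have h' := congrArg Subtype.val hxy
    have h2 := VV_D2 n d m _ hx
    rw [add_neg_cancel_right] at h2
    exact ⟨_, h2, h'⟩

theorem comp_D1 (j : ℤ) {φ : MvPolynomial (Idx n d) ℂ} (h : (D1 n d).toLinearMap φ = 0) :
    (D1 n d).toLinearMap (weightedHomogeneousComponent (wt n d) j φ) = 0 := by
  rw [← comp_comm (wt n d) 2 _ (D1_wt n d), h, map_zero]

theorem comp_D2 (j : ℤ) (s : ℕ) {φ : MvPolynomial (Idx n d) ℂ}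
    (h : ((D2 n d).toLinearMap ^ s) φ = 0) :
    ((D2 n d).toLinearMap ^ s) (weightedHomogeneousComponent (wt n d) j φ) = 0 := by
  rw [← comp_comm (wt n d) (s * (-2)) _ (fun p φ hφ => wt_D2_pow n d p hφ s), h, map_zero]

theorem comp_mdeg (j : ℤ) {φ : MvPolynomial (Idx n d) ℂ} (h : φ ∈ mdeg n d m) :
    weightedHomogeneousComponent (wt n d) j φ ∈ mdeg n d m := by
  intro α hα
  apply h α
  rw [MvPolynomial.mem_support_iff, coeff_weightedHomogeneousComponent] at hα
  rw [MvPolynomial.mem_support_iff]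
  intro h
  simp [h] at hα

theorem pow_zero_of_le {v : MvPolynomial (Idx n d) ℂ} {s t : ℕ} (hst : s ≤ t)
    (hs : ((D2 n d).toLinearMap ^ s) v = 0) : ((D2 n d).toLinearMap ^ t) v = 0 := by
  obtain ⟨r, rfl⟩ := Nat.exists_eq_add_of_le hst
  rw [add_comm, pow_add, Module.End.mul_apply, hs, map_zero]

theorem semi_step (i : ℕ) :
    Module.finrank ℂ ↥(VV n d m i ⊓ LinearMap.ker (D1 n d).toLinearMap : Submodule ℂ _) +
      Module.finrank ℂ (semiInv n d m i) = Module.finrank ℂ (semiInv n d m (i + 1)) := by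
  have := mdeg_fin n d m
  have : FiniteDimensional ℂ (semiInv n d m (i + 1)) :=
    Submodule.finiteDimensional_of_le (inf_le_left.trans inf_le_left : _ ≤ mdeg n d m)
  refine rank_null _ _ _ (weightedHomogeneousComponent (wt n d) (i : ℤ)) ?_ ?_ ?_
  · rintro x ⟨hx, h2⟩
    exact ⟨hx, pow_zero_of_le n d (Nat.le_succ i) h2⟩
  · rintro x ⟨⟨hx, h1⟩, h2⟩
    replace h1 : (D1 n d).toLinearMap x = 0 := h1
    replace h2 : ((D2 n d).toLinearMap ^ (i + 1)) x = 0 := h2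
    constructor
    · intro h0
      refine ⟨⟨hx, h1⟩, ?_⟩
      show ((D2 n d).toLinearMap ^ i) x = 0
      rw [← sum_weightedHomogeneousComponent (wt n d) x,
        finsum_eq_sum _ (weightedHomogeneousComponent_finsupp x), map_sum]
      refine Finset.sum_eq_zero fun j _ => ?_
      by_cases hj : weightedHomogeneousComponent (wt n d) j x = 0
      · rw [hj, map_zero]
      · obtain ⟨t, ht, rfl, ht2⟩ := prim_wt n d j (weightedHomogeneousComponent_isWeightedHomogeneous j x)
          (comp_D1 n d j h1) hj (i + 1) (comp_D2 n d j _ h2)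
        refine pow_zero_of_le n d ?_ ht2
        have : t ≠ i := by
          rintro rfl
          exact hj h0
        omega
    · rintro ⟨_, h3⟩
      replace h3 : ((D2 n d).toLinearMap ^ i) x = 0 := h3
      by_contra hj
      obtain ⟨t, ht, h4, _⟩ := prim_wt n d i (weightedHomogeneousComponent_isWeightedHomogeneous _ x)
          (comp_D1 n d _ h1) hj i (comp_D2 n d _ _ h3)
      omega
  · apply le_antisymm
    · rintro _ ⟨x, ⟨⟨hx, h1⟩, h2⟩, rfl⟩
      exact ⟨⟨comp_mdeg n d m _ hx, weightedHomogeneousComponent_isWeightedHomogeneous _ x⟩,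
        comp_D1 n d _ h1⟩
    · rintro x ⟨⟨hx, hw⟩, h1⟩
      refine ⟨x, ⟨⟨hx, h1⟩, ?_⟩, IsWeightedHomogeneous.weightedHomogeneousComponent_same hw⟩
      replace h1 : (D1 n d).toLinearMap x = 0 := h1
      show ((D2 n d).toLinearMap ^ (i + 1)) x = 0
      by_cases h0 : x = 0
      · rw [h0, map_zero]
      obtain ⟨t, _, h3, h4⟩ := prim_wt n d i hw h1 h0 _ (D2_nilp n d m i ⟨hx, hw⟩).choose_spec
      have : t = i := by omega
      rwa [this] at h4

end aux2

/-- The number of linearly independent joint semi-invariants of multidegree `m` and order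
exactly `i`, namely `dim W_i - dim W_{i-1}`, equals `ω_d(m; i) - ω_d(m; i + 2)`. -/
theorem dim_order_semiinvariants
    (n : ℕ) (hn : 1 ≤ n) (d : Fin n → ℕ) (hd : ∀ k, 1 ≤ d k)
    (m : Fin n → ℕ) (i : ℕ) :
    (Module.finrank ℂ ↥(semiInv n d m (i + 1)) : ℤ) -
      (Module.finrank ℂ ↥(semiInv n d m i) : ℤ) =
    (omegaCount n d m (i : ℤ) : ℤ) - (omegaCount n d m ((i : ℤ) + 2) : ℤ) := by
  have h1 := semi_step n d m i
  have := VV_fin n d m i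
  have h2 := rank_null (VV n d m i) (VV n d m i ⊓ LinearMap.ker (D1 n d).toLinearMap)
    (VV n d m (i + 2)) (D1 n d).toLinearMap inf_le_left
    (fun x hx => ⟨fun h => ⟨hx, h⟩, fun h => h.2⟩) (surj_step n d m i (by omega))
  rw [VV_finrank, VV_finrank] at h2
  omega
end

section
/- For every multidegree m ∈ ℕ^n, the ℂ-vector space of joint invariants of multidegree m, i.e., polynomials f ∈ R of multidegree m with D1(f) = 0 and D2(f) = 0, has dimension ω_d(m;0) − ω_d(m;2). -/
open MvPolynomial

theorem sl2_inj {V : Type*} [AddCommGroup V] [Module ℂ V] (A B : V →ₗ[ℂ] V)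
    (W : ℤ → Submodule ℂ V) (N : ℤ)
    (hA : ∀ i f, f ∈ W i → A f ∈ W (i+2))
    (hAB : ∀ i f, f ∈ W i → A (B f) - B (A f) = (i:ℂ) • f)
    (hN : ∀ i f, f ∈ W i → N < i → f = 0)
    (i : ℤ) (hi : 0 < i) (f : V) (hf : f ∈ W i) (h : A (B f) = 0) : f = 0 := by
  have hmem : ∀ k : ℕ, (A^k) f ∈ W (i + 2*k) := by
    intro k
    induction k with
    | zero => simpa using hf
    | succ k ih =>
      rw [pow_succ', Module.End.mul_apply]
      have := hA _ _ ih
      convert this using 2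
      push_cast; ring
  have key : ∀ k : ℕ, ∃ c : ℕ, 0 < c ∧ B ((A^(k+1)) f) = -(c:ℂ) • (A^k) f := by
    intro k
    induction k with
    | zero =>
      refine ⟨i.toNat, by omega, ?_⟩
      have h1 := hAB i f hf
      rw [h, zero_sub] at h1
      have : ((i.toNat : ℕ) : ℂ) = (i:ℂ) := by
        have : ((i.toNat : ℕ) : ℤ) = i := by omega
        exact_mod_cast congrArg (Int.cast : ℤ → ℂ) this
      simp only [zero_add, pow_one, pow_zero, Module.End.one_apply]
      rw [this, neg_smul, ← h1, neg_neg]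
    | succ k ih =>
      obtain ⟨c, hc, h2⟩ := ih
      refine ⟨c + (i + 2 * (k+1)).toNat, by omega, ?_⟩
      have h1 := hAB _ _ (hmem (k+1))
      rw [h2, map_smul, ← Module.End.mul_apply A (A^k), ← Module.End.mul_apply A (A^(k+1)), ← pow_succ', ← pow_succ'] at h1
      have h3 : (((i + 2 * (k+1)).toNat : ℕ) : ℂ) = ((i + 2 * ((k+1:ℕ):ℤ) : ℤ):ℂ) := by
        have : (((i + 2 * (k+1)).toNat : ℕ) : ℤ) = i + 2 * ((k+1:ℕ):ℤ) := by omega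
        exact_mod_cast congrArg (Int.cast : ℤ → ℂ) this
      rw [Nat.cast_add, h3, neg_add, add_smul, neg_smul _ ((A^(k+1)) f), neg_smul _ ((A^(k+1)) f), ← h1]
      module
  have hz : (A^((N-i).toNat+1)) f = 0 := by
    apply hN _ _ (hmem _)
    push_cast; omega
  generalize (N-i).toNat+1 = K at hz
  induction K with
  | zero => simpa using hz
  | succ K ih =>
    apply ih
    obtain ⟨c, hc, h2⟩ := key K
    rw [hz, map_zero] at h2
    have := smul_eq_zero.mp h2.symm
    rcases this with h | h
    · simp at h; omega
    · exact h

theorem sl2_dim {V : Type*} [AddCommGroup V] [Module ℂ V] (A B : V →ₗ[ℂ] V)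
    (W : ℤ → Submodule ℂ V) (N : ℤ)
    (hA : ∀ i f, f ∈ W i → A f ∈ W (i+2))
    (hB : ∀ i f, f ∈ W i → B f ∈ W (i-2))
    (hAB : ∀ i f, f ∈ W i → A (B f) - B (A f) = (i:ℂ) • f)
    (hN : ∀ i f, f ∈ W i → N < |i| → f = 0)
    [FiniteDimensional ℂ (W 0)] [FiniteDimensional ℂ (W 2)] :
    Module.finrank ℂ ↥(W 0 ⊓ LinearMap.ker A ⊓ LinearMap.ker B) + Module.finrank ℂ (W 2)
     = Module.finrank ℂ (W 0) := by
  have e : W 0 ⊓ LinearMap.ker A ⊓ LinearMap.ker B = W 0 ⊓ LinearMap.ker A := by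
    apply le_antisymm inf_le_left
    rintro f ⟨hf, hAf⟩
    refine ⟨⟨hf, hAf⟩, ?_⟩
    have hAf' : A f = 0 := hAf
    have h1 := hAB 0 f hf
    rw [hAf'] at h1
    simp only [map_zero, sub_zero, Int.cast_zero, zero_smul] at h1
    have hBf := hB 0 f hf
    apply sl2_inj B A (fun i => W (-i)) N ?_ ?_ ?_ 2 (by norm_num) (B f) (by simpa using hBf) (by rw [h1, map_zero])
    · intro i f hf
      have := hB _ _ hf
      convert this using 2
      ring
    · intro i f hf
      have := hAB _ _ hf
      rw [← neg_sub, this]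
      push_cast; module
    · intro i f hf hi
      exact hN _ _ hf (by rw [abs_neg]; exact hi.trans_le (le_abs_self i))
  rw [e]
  let a : W 0 →ₗ[ℂ] W 2 := A.restrict (fun f hf => by simpa using hA 0 f hf)
  let b : W 2 →ₗ[ℂ] W 0 := B.restrict (fun f hf => by simpa using hB 2 f hf)
  have inj : Function.Injective (a ∘ₗ b) := by
    rw [← LinearMap.ker_eq_bot, LinearMap.ker_eq_bot']
    intro f hf
    have : A (B f.1) = 0 := congrArg Subtype.val hf
    apply Subtype.ext
    exact sl2_inj A B W N hA hAB (fun i f hf hi => hN i f hf (hi.trans_le (le_abs_self i))) 2 (by norm_num) f.1 f.2 this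
  have surj : Function.Surjective a := by
    have := LinearMap.surjective_of_injective inj
    exact Function.Surjective.of_comp (g := b) this
  have rn := LinearMap.finrank_range_add_finrank_ker a
  rw [LinearMap.range_eq_top.mpr surj, finrank_top] at rn
  have : Module.finrank ℂ ↥(W 0 ⊓ LinearMap.ker A) = Module.finrank ℂ (LinearMap.ker a) := by
    have h : LinearMap.ker a = (W 0 ⊓ LinearMap.ker A).comap (W 0).subtype := by
      ext f
      simp [a, LinearMap.mem_ker, Subtype.ext_iff]
    rw [h]
    exact (LinearEquiv.finrank_eq (Submodule.comapSubtypeEquivOfLe inf_le_left)).symm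
  omega

def wtI (n : ℕ) (d : Fin n → ℕ) (α : Idx n d →₀ ℕ) : ℤ :=
  ∑ k : Fin n, ∑ j : Fin (d k + 1), ((d k : ℤ) - 2 * (j : ℕ)) * (α ⟨k, j⟩ : ℤ)

def degI (n : ℕ) (d : Fin n → ℕ) (k : Fin n) (α : Idx n d →₀ ℕ) : ℕ :=
  ∑ j : Fin (d k + 1), α ⟨k, j⟩

theorem wtI_add (n : ℕ) (d : Fin n → ℕ) (α β : Idx n d →₀ ℕ) :
    wtI n d (α + β) = wtI n d α + wtI n d β := by
  simp [wtI, mul_add, Finset.sum_add_distrib]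

theorem degI_add (n : ℕ) (d : Fin n → ℕ) (k : Fin n) (α β : Idx n d →₀ ℕ) :
    degI n d k (α + β) = degI n d k α + degI n d k β := by
  simp [degI, Finset.sum_add_distrib]

theorem wtI_eq (n : ℕ) (d : Fin n → ℕ) (α : Idx n d →₀ ℕ) :
    wtI n d α = ∑ x : Idx n d, ((d x.1 : ℤ) - 2 * (x.2 : ℕ)) * (α x : ℤ) := by
  rw [Fintype.sum_sigma]; rfl

theorem degI_eq (n : ℕ) (d : Fin n → ℕ) (k : Fin n) (α : Idx n d →₀ ℕ) :
    degI n d k α = ∑ x : Idx n d, if x.1 = k then α x else 0 := by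
  rw [Fintype.sum_sigma, Finset.sum_eq_single k]
  · simp [degI]
  · intro b _ hb; simp [hb]
  · simp

theorem wtI_single (n : ℕ) (d : Fin n → ℕ) (x : Idx n d) :
    wtI n d (Finsupp.single x 1) = (d x.1 : ℤ) - 2 * (x.2 : ℕ) := by
  classical
  rw [wtI_eq, Finset.sum_eq_single x]
  · simp
  · intro b _ hb; simp [Finsupp.single_apply, hb.symm]
  · simp

theorem degI_single (n : ℕ) (d : Fin n → ℕ) (k : Fin n) (x : Idx n d) :
    degI n d k (Finsupp.single x 1) = if x.1 = k then 1 else 0 := by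
  classical
  rw [degI_eq, Finset.sum_eq_single x]
  · simp
  · intro b _ hb; simp [Finsupp.single_apply, hb.symm]
  · simp

def setW (n : ℕ) (d : Fin n → ℕ) (m : Fin n → ℕ) (i : ℤ) : Set (Idx n d →₀ ℕ) :=
  {α | (∀ k, degI n d k α = m k) ∧ wtI n d α = i}

theorem finite_deg (n : ℕ) (d : Fin n → ℕ) (m : Fin n → ℕ) :
    {α : Idx n d →₀ ℕ | ∀ k, degI n d k α = m k}.Finite := by
  apply Set.Finite.subset (Set.finite_Iic (Finsupp.equivFunOnFinite.symm (fun x : Idx n d => m x.1)))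
  intro α hα x
  have := hα x.1
  simp only [Finsupp.equivFunOnFinite_symm_apply_apply]
  rw [← this]
  exact Finset.single_le_sum (f := fun j => α ⟨x.1, j⟩) (fun _ _ => Nat.zero_le _) (Finset.mem_univ x.2)

theorem deriv_maps (n : ℕ) (d : Fin n → ℕ) (m : Fin n → ℕ) (i δ : ℤ)
    (g : Idx n d → MvPolynomial (Idx n d) ℂ)
    (hg : ∀ x, g x = 0 ∨ ∃ (c : ℂ) (y : Idx n d), g x = c • X y ∧ y.1 = x.1 ∧
      (d y.1 : ℤ) - 2 * (y.2 : ℕ) = (d x.1 : ℤ) - 2 * (x.2 : ℕ) + δ)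
    (f : MvPolynomial (Idx n d) ℂ) (hf : f ∈ restrictSupport ℂ (setW n d m i)) :
    mkDerivation ℂ g f ∈ restrictSupport ℂ (setW n d m (i + δ)) := by
  rw [restrictSupport_eq_span] at hf
  induction hf using Submodule.span_induction with
  | zero => simp
  | add a b _ _ ha hb => rw [map_add]; exact Submodule.add_mem _ ha hb
  | smul c a _ ha => rw [Derivation.map_smul]; exact Submodule.smul_mem _ _ ha
  | mem p hp =>
    obtain ⟨α, ⟨hα1, hα2⟩, rfl⟩ := hp
    simp only
    rw [mkDerivation_monomial, one_smul]
    apply Submodule.sum_mem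
    intro x hx
    rcases hg x with h | ⟨c, y, h, hy1, hy2⟩
    · simp [h]
    · simp only [h]
      rw [smul_comm]
      apply Submodule.smul_mem
      rw [smul_eq_mul, X, monomial_mul, monomial_mem_restrictSupport]
      left
      have hx' : Finsupp.single x 1 ≤ α := by
        rw [Finsupp.single_le_iff]
        have := Finsupp.mem_support_iff.mp hx
        omega
      obtain ⟨β, rfl⟩ := exists_add_of_le hx'
      rw [add_tsub_cancel_left]
      constructor
      · intro k
        rw [← hα1 k, degI_add, degI_add, degI_single, degI_single, hy1, add_comm]
      · rw [wtI_add, wtI_single] at *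
        rw [hy2]; omega

theorem E_monomial (n : ℕ) (d : Fin n → ℕ) (α : Idx n d →₀ ℕ) (c : ℂ) :
    E n d (monomial α c) = (wtI n d α : ℂ) • monomial α c := by
  rw [E, mkDerivation_monomial, wtI_eq, Finsupp.sum_fintype _ _ (by simp)]
  push_cast
  rw [Finset.sum_smul, Finset.smul_sum]
  apply Finset.sum_congr rfl
  intro x _
  by_cases h : α x = 0
  · simp [h]
  have hx' : Finsupp.single x 1 ≤ α := by
    rw [Finsupp.single_le_iff]
    omega
  rw [smul_eq_mul, mul_smul_comm, X, monomial_mul, tsub_add_cancel_of_le hx', smul_monomial, smul_monomial, smul_monomial]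
  congr 1
  simp; ring

theorem coeff_E (n : ℕ) (d : Fin n → ℕ) (α : Idx n d →₀ ℕ) (f : MvPolynomial (Idx n d) ℂ) :
    coeff α (E n d f) = (wtI n d α : ℂ) * coeff α f := by
  classical
  induction f using MvPolynomial.induction_on' with
  | monomial β c =>
    rw [E_monomial, coeff_smul, coeff_monomial, smul_eq_mul]
    split_ifs with h
    · rw [h]
    · simp
  | add p q hp hq => rw [map_add, coeff_add, coeff_add, hp, hq, mul_add]

theorem D1D2 (n : ℕ) (d : Fin n → ℕ) (f : MvPolynomial (Idx n d) ℂ) :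
    D1 n d (D2 n d f) - D2 n d (D1 n d f) = E n d f := by
  rw [← Derivation.commutator_apply]
  congr 1
  apply derivation_ext
  rintro ⟨k, j, hj⟩
  rw [Derivation.commutator_apply]
  have e1 : ∀ (j : ℕ) (hj : j < d k + 1) (hj' : j + 1 < d k + 1),
      D1 n d (X ⟨k, ⟨j+1, hj'⟩⟩) = ((j:ℂ)+1) • X ⟨k, ⟨j, hj⟩⟩ := by
    intro j hj hj'
    simp [D1, mkDerivation_X]
  have e0 : ∀ (hj : 0 < d k + 1), D1 n d (X ⟨k, ⟨0, hj⟩⟩) = 0 := by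
    intro hj
    simp [D1, mkDerivation_X]
  have f1 : ∀ (j : ℕ) (hj : j < d k + 1) (hj' : j + 1 < d k + 1),
      D2 n d (X ⟨k, ⟨j, hj⟩⟩) = ((d k:ℂ)-j) • X ⟨k, ⟨j+1, hj'⟩⟩ := by
    intro j hj hj'
    simp only [D2, mkDerivation_X]
    rw [dif_neg (by omega), Nat.cast_sub (by omega)]
  have f0 : ∀ (j : ℕ) (hj : j < d k + 1), j = d k → D2 n d (X ⟨k, ⟨j, hj⟩⟩) = 0 := by
    intro j hj h
    simp [D2, mkDerivation_X, h]
  have hE : E n d (X ⟨k, ⟨j, hj⟩⟩) = ((d k : ℂ) - 2 * (j:ℂ)) • X ⟨k, ⟨j, hj⟩⟩ := by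
    simp [E, mkDerivation_X]
  rw [hE]
  by_cases h1 : j = d k
  · rw [f0 j hj h1]
    rcases j with _ | j
    · rw [e0]; simp [← h1]
    · rw [e1 j (by omega) hj, Derivation.map_smul, f1 j (by omega) hj, smul_smul, map_zero, zero_sub, ← neg_smul]
      have h2 : (d k : ℂ) = (j:ℂ) + 1 := by exact_mod_cast h1.symm
      congr 1; rw [h2]; push_cast; ring
  · rw [f1 j hj (by omega), Derivation.map_smul, e1 j hj (by omega)]
    rcases j with _ | j
    · rw [e0]; simp
    · rw [e1 j (by omega) hj, Derivation.map_smul, f1 j (by omega) hj, smul_smul, smul_smul, ← sub_smul]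
      congr 1; push_cast; ring

theorem finrank_setW (n : ℕ) (d : Fin n → ℕ) (m : Fin n → ℕ) (i : ℤ) :
    Module.finrank ℂ (restrictSupport ℂ (setW n d m i)) = omegaCount n d m i := by
  rw [Module.finrank_eq_nat_card_basis (basisRestrictSupport ℂ (setW n d m i))]
  exact Nat.card_congr (Finsupp.equivFunOnFinite.subtypeEquiv (fun α => Iff.rfl))

theorem fd_setW (n : ℕ) (d : Fin n → ℕ) (m : Fin n → ℕ) (i : ℤ) :
    FiniteDimensional ℂ (restrictSupport ℂ (setW n d m i)) := by
  have : Finite (setW n d m i) := ((finite_deg n d m).subset (fun α h => h.1)).to_subtype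
  exact Module.Finite.of_basis (basisRestrictSupport ℂ (setW n d m i))

/-- The space of joint invariants of multidegree `m` (polynomials of multidegree `m`
with `D1 f = 0` and `D2 f = 0`) has dimension `ω_d(m; 0) - ω_d(m; 2)`. -/
theorem dim_invariants_eq_omega_sub_omega
    (n : ℕ) (hn : 1 ≤ n) (d : Fin n → ℕ) (hd : ∀ k, 1 ≤ d k)
    (m : Fin n → ℕ) :
    (Module.finrank ℂ ↥(mdeg n d m ⊓ LinearMap.ker (D1 n d).toLinearMap ⊓
        LinearMap.ker (D2 n d).toLinearMap) : ℤ) =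
      (omegaCount n d m 0 : ℤ) - (omegaCount n d m 2 : ℤ) := by
  have := fd_setW n d m 0
  have := fd_setW n d m 2
  obtain ⟨N, hN⟩ := ((finite_deg n d m).image (fun α => |wtI n d α|)).bddAbove
  have key := sl2_dim (D1 n d).toLinearMap (D2 n d).toLinearMap
    (fun i => restrictSupport ℂ (setW n d m i)) N ?_ ?_ ?_ ?_
  · have e : mdeg n d m ⊓ LinearMap.ker (D1 n d).toLinearMap ⊓
        LinearMap.ker (D2 n d).toLinearMap = restrictSupport ℂ (setW n d m 0) ⊓
        LinearMap.ker (D1 n d).toLinearMap ⊓ LinearMap.ker (D2 n d).toLinearMap := by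
      apply le_antisymm
      · rintro f ⟨⟨hf, h1⟩, h2⟩
        refine ⟨⟨?_, h1⟩, h2⟩
        have h1' : D1 n d f = 0 := h1
        have h2' : D2 n d f = 0 := h2
        have hE := D1D2 n d f
        rw [h1', h2', map_zero, map_zero, sub_zero] at hE
        intro α hα
        refine ⟨hf α hα, ?_⟩
        have := coeff_E n d α f
        rw [← hE, coeff_zero] at this
        have h3 : coeff α f ≠ 0 := mem_support_iff.mp hα
        rcases mul_eq_zero.mp this.symm with h | h
        · exact_mod_cast h
        · exact absurd h h3
      · rintro f ⟨⟨hf, h1⟩, h2⟩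
        exact ⟨⟨fun α hα => (hf hα).1, h1⟩, h2⟩
    rw [e]
    simp only [finrank_setW] at key
    omega
  · intro i f hf
    apply deriv_maps n d m i 2 _ _ f hf
    intro x
    by_cases h : x.2.1 = 0
    · left; simp [h]
    · right
      refine ⟨_, _, dif_neg h, rfl, ?_⟩
      simp only
      omega
  · intro i f hf
    apply deriv_maps n d m i (-2) _ _ f hf
    intro x
    by_cases h : x.2.1 = d x.1
    · left; simp [h]
    · right
      refine ⟨_, _, dif_neg h, rfl, ?_⟩
      simp only
      omega
  · intro i f hf
    change D1 n d (D2 n d f) - D2 n d (D1 n d f) = _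
    rw [D1D2]
    ext α
    rw [coeff_E, coeff_smul, smul_eq_mul]
    by_cases h : α ∈ f.support
    · rw [(hf h).2]
    · rw [notMem_support_iff.mp h]; simp
  · intro i f hf hi
    by_contra h0
    obtain ⟨α, hα⟩ := Finset.nonempty_of_ne_empty (fun h => h0 (support_eq_empty.mp h))
    have h1 := hf hα
    have := hN (Set.mem_image_of_mem _ h1.1)
    simp only [h1.2] at this
    omega
end
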